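/- There exists a constant C > 0 such that for all integers k > j ≥ 1, the uniform bridge B(k,·) in 𝓑_k^{≥−1} satisfies E[|B(k,j)|^4] ≤ C j^2. -/

import Mathlib

open MeasureTheory ProbabilityTheory Filter
open scoped ENNReal Classical

/-- The set `𝓑_k^{≥−1}` of discrete bridges: integer sequences `(b 1, …, b k)`
(0-indexed here as `b : Fin k → ℤ`) all of whose increments, starting from `b 0 = 0`,
are at least `-1`, and which end at `0`. -/
def IsBridge {k : ℕ} (b : Fin k → ℤ) : Prop :=
  (∀ i : Fin k, -1 ≤ (Fin.cons 0 b : Fin (k + 1) → ℤ) i.succ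
      - (Fin.cons 0 b : Fin (k + 1) → ℤ) i.castSucc) ∧
  (Fin.cons (0 : ℤ) b : Fin (k + 1) → ℤ) (Fin.last k) = 0

namespace Nat

lemma succ_mul_multichoose_succ (K n : ℕ) :
    (n + 1) * K.multichoose (n + 1) = K * (K + 1).multichoose n := by
  rcases K with _ | K
  · simp
  · have h := Nat.choose_succ_right_eq (K + 1 + n) n
    simp only [Nat.multichoose_eq]
    have e₁ : K + 1 + (n + 1) - 1 = K + 1 + n := by omega
    have e₂ : K + 1 + 1 + n - 1 = K + 1 + n := by omega
    have e₃ : K + 1 + n - n = K + 1 := by omega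
    rw [e₃] at h
    rw [e₁, e₂, mul_comm, h, mul_comm]

end Nat

/-- Summing a function of the partial sum over `s` over all weak compositions of `n`
indexed by `s ∪ t`. -/
lemma sum_finsuppAntidiag_union {ι : Type*} [DecidableEq ι] {R : Type*} [Semiring R]
    {s t : Finset ι} (hst : Disjoint s t) (n : ℕ) (g : ℕ → R) :
    ∑ x ∈ (s ∪ t).finsuppAntidiag n, g (∑ i ∈ s, x i) =
      ∑ p ∈ Finset.HasAntidiagonal.antidiagonal n,
        g p.1 * ((s.card.multichoose p.1 : R) * (t.card.multichoose p.2 : R)) := by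
  have hfilter : ∀ (x : ι →₀ ℕ) (u : Finset ι),
      ∑ i ∈ u, (x.filter (· ∈ u)) i = ∑ i ∈ u, x i := fun x u =>
    Finset.sum_congr rfl fun i hi => Finsupp.filter_apply_pos _ _ hi
  have hzero : ∀ (u v : Finset ι) (y : ι →₀ ℕ), Disjoint u v → y.support ⊆ v →
      ∀ i ∈ u, y i = 0 := by
    intro u v y huv hy i hi
    by_contra h
    exact Finset.disjoint_left.1 huv hi (hy (Finsupp.mem_support_iff.2 h))
  have key : ∑ x ∈ (s ∪ t).finsuppAntidiag n, g (∑ i ∈ s, x i) =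
      ∑ q ∈ (Finset.HasAntidiagonal.antidiagonal n).sigma
        (fun p => s.finsuppAntidiag p.1 ×ˢ t.finsuppAntidiag p.2), g q.1.1 := by
    refine Finset.sum_bij'
      (fun x _ => ⟨(∑ i ∈ s, x i, ∑ i ∈ t, x i),
        (x.filter (· ∈ s), x.filter (· ∈ t))⟩)
      (fun q _ => q.2.1 + q.2.2) ?_ ?_ ?_ ?_ ?_
    · intro x hx
      rw [Finset.mem_finsuppAntidiag, Finset.sum_union hst] at hx
      simp only [Finset.mem_sigma, Finset.HasAntidiagonal.mem_antidiagonal, Finset.mem_product,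
        Finset.mem_finsuppAntidiag, hfilter, true_and]
      refine ⟨hx.1, ?_, ?_⟩ <;> intro i hi <;> simp at hi <;> exact hi.2
    · rintro ⟨⟨a, b⟩, y, z⟩ hq
      simp only [Finset.mem_sigma, Finset.HasAntidiagonal.mem_antidiagonal, Finset.mem_product,
        Finset.mem_finsuppAntidiag] at hq
      obtain ⟨hab, ⟨hy, hys⟩, hz, hzt⟩ := hq
      rw [Finset.mem_finsuppAntidiag, Finset.sum_union hst]
      simp only [Finsupp.add_apply, Finset.sum_add_distrib]
      rw [hy, hz, Finset.sum_eq_zero (hzero s t z hst hzt),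
        Finset.sum_eq_zero (hzero t s y hst.symm hys)]
      refine ⟨by omega, Finsupp.support_add.trans (Finset.union_subset_union hys hzt)⟩
    · intro x hx
      rw [Finset.mem_finsuppAntidiag] at hx
      ext i
      by_cases his : i ∈ s
      · have hit := Finset.disjoint_left.1 hst his
        simp [his, hit]
      · by_cases hit : i ∈ t
        · simp [his, hit]
        · have : x i = 0 := by
            by_contra h
            have := hx.2 (Finsupp.mem_support_iff.2 h)
            simp [his, hit] at this
          simp [his, hit, this]
    · rintro ⟨⟨a, b⟩, y, z⟩ hq
      simp only [Finset.mem_sigma, Finset.HasAntidiagonal.mem_antidiagonal, Finset.mem_product,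
        Finset.mem_finsuppAntidiag] at hq
      obtain ⟨hab, ⟨hy, hys⟩, hz, hzt⟩ := hq
      have h₁ : ∑ i ∈ s, (y + z) i = a := by
        simp only [Finsupp.add_apply, Finset.sum_add_distrib]
        rw [hy, Finset.sum_eq_zero (hzero s t z hst hzt), add_zero]
      have h₂ : ∑ i ∈ t, (y + z) i = b := by
        simp only [Finsupp.add_apply, Finset.sum_add_distrib]
        rw [hz, Finset.sum_eq_zero (hzero t s y hst.symm hys), zero_add]
      have h₃ : (y + z).filter (· ∈ s) = y := by
        ext i
        by_cases his : i ∈ s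
        · simp [his, hzero s t z hst hzt i his]
        · simp only [his, not_false_eq_true, Finsupp.filter_apply_neg]
          by_contra h
          exact his (hys (Finsupp.mem_support_iff.2 (Ne.symm h)))
      have h₄ : (y + z).filter (· ∈ t) = z := by
        ext i
        by_cases hit : i ∈ t
        · simp [hit, hzero t s y hst.symm hys i hit]
        · simp only [hit, not_false_eq_true, Finsupp.filter_apply_neg]
          by_contra h
          exact hit (hzt (Finsupp.mem_support_iff.2 (Ne.symm h)))
      simp only [h₁, h₂, h₃, h₄]
    · intro x _
      rfl
  rw [key, Finset.sum_sigma]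
  refine Finset.sum_congr rfl fun p _ => ?_
  simp only [Finset.sum_const, Finset.card_product,
    Finset.card_finsuppAntidiag_nat_eq_multichoose, nsmul_eq_mul, Nat.cast_mul]
  rw [← Nat.cast_mul, ← (Nat.cast_commute _ _).eq]

lemma sum_antidiagonal_multichoose_mul (j m n : ℕ) :
    ∑ p ∈ Finset.HasAntidiagonal.antidiagonal n, j.multichoose p.1 * m.multichoose p.2 =
      (j + m).multichoose n := by
  have hd : Disjoint (Finset.range j) (Finset.Ico j (j + m)) :=
    Finset.disjoint_left.2 fun i hi hi' => by simp at hi hi'; omega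
  have h := sum_finsuppAntidiag_union hd n (fun _ => (1 : ℕ))
  simp only [Finset.sum_const, Finset.card_finsuppAntidiag_nat_eq_multichoose,
    Finset.card_union_of_disjoint hd, Finset.card_range, Nat.card_Ico, Nat.cast_id,
    smul_eq_mul, one_mul, mul_one, Nat.add_sub_cancel_left] at h
  exact h.symm

/-- The factorial moments of the Pólya urn distribution, cleared of denominators. -/
lemma sum_antidiagonal_descFactorial_mul_multichoose (r : ℕ) : ∀ j m n : ℕ,
    (∑ p ∈ Finset.HasAntidiagonal.antidiagonal n,
        p.1.descFactorial r * (j.multichoose p.1 * m.multichoose p.2)) *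
      (j + m).ascFactorial r =
    j.ascFactorial r * n.descFactorial r * (j + m).multichoose n := by
  induction r with
  | zero =>
    intro j m n
    simp [sum_antidiagonal_multichoose_mul]
  | succ r ih =>
    intro j m n
    rcases n with _ | n
    · simp
    · have hasc : ∀ a : ℕ, a.ascFactorial (r + 1) = a * (a + 1).ascFactorial r := fun a => by
        rw [Nat.ascFactorial_succ, ← Nat.succ_ascFactorial]
      rw [Finset.Nat.sum_antidiagonal_succ]
      simp only [Nat.zero_descFactorial_succ, zero_mul, zero_add,
        Nat.succ_descFactorial_succ]
      have hterm : ∀ p : ℕ × ℕ,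
          (p.1 + 1) * p.1.descFactorial r * (j.multichoose (p.1 + 1) * m.multichoose p.2) =
          j * (p.1.descFactorial r * ((j + 1).multichoose p.1 * m.multichoose p.2)) := by
        intro p
        calc _ = ((p.1 + 1) * j.multichoose (p.1 + 1)) *
              (p.1.descFactorial r * m.multichoose p.2) := by ring
          _ = _ := by rw [Nat.succ_mul_multichoose_succ]; ring
      simp only [hterm]
      rw [← Finset.mul_sum, hasc, hasc]
      have h := ih (j + 1) m n
      rw [show j + 1 + m = j + m + 1 by ring] at h
      have h' := Nat.succ_mul_multichoose_succ (j + m) n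
      calc _ = j * (j + m) * ((∑ p ∈ Finset.HasAntidiagonal.antidiagonal n, p.1.descFactorial r *
              ((j + 1).multichoose p.1 * m.multichoose p.2)) *
              (j + m + 1).ascFactorial r) := by ring
        _ = j * (j + 1).ascFactorial r * n.descFactorial r *
              ((j + m) * (j + m + 1).multichoose n) := by rw [h]; ring
        _ = _ := by rw [← h']; ring

/-- The fourth central moment of the Pólya urn distribution is at most `100 j ^ 2`. -/
lemma sum_antidiagonal_sub_pow_four_le (j m : ℕ) (hj : 1 ≤ j) (hm : 1 ≤ m) :
    ∑ p ∈ Finset.HasAntidiagonal.antidiagonal (j + m),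
        ((p.1 : ℝ) - j) ^ 4 * ((j.multichoose p.1 : ℝ) * (m.multichoose p.2 : ℝ)) ≤
      100 * (j : ℝ) ^ 2 * ((j + m).multichoose (j + m) : ℝ) := by
  set N : ℝ := ((j + m).multichoose (j + m) : ℝ) with hN
  set M : ℕ → ℝ := fun r => ∑ p ∈ Finset.HasAntidiagonal.antidiagonal (j + m),
    (p.1.descFactorial r : ℝ) * ((j.multichoose p.1 : ℝ) * (m.multichoose p.2 : ℝ)) with hM
  have hmom : ∀ r, M r * ((j + m).ascFactorial r : ℝ) =
      (j.ascFactorial r : ℝ) * ((j + m).descFactorial r : ℝ) * N := by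
    intro r
    simp only [hM, hN]
    exact_mod_cast sum_antidiagonal_descFactorial_mul_multichoose r j m (j + m)
  have hdesc : ∀ (r n : ℕ), (n.descFactorial r : ℝ) = (descPochhammer ℝ r).eval (n : ℝ) :=
    fun r n => (descPochhammer_eval_eq_descFactorial ℝ n r).symm
  have hsplit : ∑ p ∈ Finset.HasAntidiagonal.antidiagonal (j + m),
        ((p.1 : ℝ) - j) ^ 4 * ((j.multichoose p.1 : ℝ) * (m.multichoose p.2 : ℝ)) =
      M 4 + (6 - 4 * j) * M 3 + (7 - 12 * j + 6 * j ^ 2) * M 2 +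
        (1 - 4 * j + 6 * j ^ 2 - 4 * j ^ 3) * M 1 + (j : ℝ) ^ 4 * M 0 := by
    simp only [hM, Finset.mul_sum, ← Finset.sum_add_distrib]
    refine Finset.sum_congr rfl fun p _ => ?_
    simp only [hdesc, descPochhammer_succ_eval, descPochhammer_zero, Polynomial.eval_one]
    push_cast
    ring
  have hNpos : 0 ≤ N := Nat.cast_nonneg _
  have h0 := hmom 0
  have h1 := hmom 1
  have h2 := hmom 2
  have h3 := hmom 3
  have h4 := hmom 4
  clear_value M N
  rw [hsplit]
  obtain ⟨a, rfl⟩ := Nat.exists_eq_add_of_le' hj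
  obtain ⟨b, rfl⟩ := Nat.exists_eq_add_of_le' hm
  simp only [hdesc, descPochhammer_succ_eval, descPochhammer_zero, Polynomial.eval_one,
    Nat.ascFactorial_succ, Nat.ascFactorial_zero] at h0 h1 h2 h3 h4
  push_cast at h0 h1 h2 h3 h4 ⊢
  have ha : (0 : ℝ) ≤ a := Nat.cast_nonneg _
  have hb : (0 : ℝ) ≤ b := Nat.cast_nonneg _
  generalize (a : ℝ) = x at *
  generalize (b : ℝ) = y at *
  set k : ℝ := x + 1 + (y + 1) with hk
  have hkpos : 0 < k := by positivity
  have e0 : M 0 = N := by linarith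
  have e1 : M 1 = (x + 1) * N := by
    apply mul_right_cancel₀ hkpos.ne'
    linear_combination h1
  have e2 : M 2 = (x + 1) * (x + 2) * (k - 1) / (k + 1) * N := by
    field_simp
    apply mul_right_cancel₀ hkpos.ne'
    linear_combination h2
  have e3 : M 3 = (x + 1) * (x + 2) * (x + 3) * (k - 1) * (k - 2) /
      ((k + 1) * (k + 2)) * N := by
    field_simp
    apply mul_right_cancel₀ hkpos.ne'
    linear_combination h3
  have e4 : M 4 = (x + 1) * (x + 2) * (x + 3) * (x + 4) * (k - 1) * (k - 2) * (k - 3) /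
      ((k + 1) * (k + 2) * (k + 3)) * N := by
    field_simp
    apply mul_right_cancel₀ hkpos.ne'
    linear_combination h4
  rw [e0, e1, e2, e3, e4, ← sub_nonneg]
  have hpoly : 0 ≤ 100 * (x + 1) ^ 2 * ((k + 1) * (k + 2) * (k + 3)) -
      ((x + 1) * (x + 2) * (x + 3) * (x + 4) * (k - 1) * (k - 2) * (k - 3) +
      (6 - 4 * (x + 1)) * ((x + 1) * (x + 2) * (x + 3) * (k - 1) * (k - 2) * (k + 3)) +
      (7 - 12 * (x + 1) + 6 * (x + 1) ^ 2) *
        ((x + 1) * (x + 2) * (k - 1) * (k + 2) * (k + 3)) +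
      ((1 - 4 * (x + 1) + 6 * (x + 1) ^ 2 - 4 * (x + 1) ^ 3) * (x + 1) + (x + 1) ^ 4) *
        ((k + 1) * (k + 2) * (k + 3))) := by
    simp only [hk]
    ring_nf
    positivity
  refine le_of_le_of_eq (mul_nonneg (div_nonneg hpoly
    (by positivity : 0 ≤ (k + 1) * (k + 2) * (k + 3))) hNpos) ?_
  field_simp
  ring

/-- The sequence of values at times `1, …, k` of the walk with increments `x i - 1`. -/
def walkOf {k : ℕ} (x : Fin k →₀ ℕ) (i : Fin k) : ℤ :=
  ((∑ l ∈ Finset.univ.filter (fun l : Fin k => l.val < i.val + 1), x l : ℕ) : ℤ) - (i.val + 1 : ℕ)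

lemma cons_walkOf {k : ℕ} (x : Fin k →₀ ℕ) (i : Fin (k + 1)) :
    (Fin.cons 0 (walkOf x) : Fin (k + 1) → ℤ) i =
      ((∑ l ∈ Finset.univ.filter (fun l : Fin k => l.val < i.val), x l : ℕ) : ℤ) - i.val := by
  refine Fin.cases ?_ (fun i => ?_) i
  · simp
  · simp [walkOf]

lemma sum_filter_val_lt_succ {k : ℕ} (x : Fin k → ℕ) (i : Fin k) :
    ∑ l ∈ Finset.univ.filter (fun l : Fin k => l.val < i.val + 1), x l =
      x i + ∑ l ∈ Finset.univ.filter (fun l : Fin k => l.val < i.val), x l := by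
  rw [← Finset.sum_insert (by simp)]
  congr 1
  ext l
  simp [Fin.ext_iff]
  omega

lemma cons_walkOf_increment {k : ℕ} (x : Fin k →₀ ℕ) (i : Fin k) :
    (Fin.cons 0 (walkOf x) : Fin (k + 1) → ℤ) i.succ -
      (Fin.cons 0 (walkOf x) : Fin (k + 1) → ℤ) i.castSucc = x i - 1 := by
  rw [cons_walkOf, cons_walkOf, Fin.val_succ, Fin.val_castSucc, sum_filter_val_lt_succ]
  push_cast
  ring

lemma walkOf_injective (k : ℕ) : Function.Injective (walkOf (k := k)) := by
  intro x y h
  ext i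
  have hx := cons_walkOf_increment x i
  have hy := cons_walkOf_increment y i
  rw [h] at hx
  omega

lemma isBridge_walkOf_iff {k : ℕ} (x : Fin k →₀ ℕ) :
    IsBridge (walkOf x) ↔ ∑ i, x i = k := by
  have hlast : (Fin.cons 0 (walkOf x) : Fin (k + 1) → ℤ) (Fin.last k) =
      ((∑ i, x i : ℕ) : ℤ) - k := by
    rw [cons_walkOf]
    simp
  unfold IsBridge
  rw [hlast]
  constructor
  · rintro ⟨-, h⟩
    omega
  · intro h
    refine ⟨fun i => ?_, by omega⟩
    rw [cons_walkOf_increment]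
    omega

lemma IsBridge.exists_walkOf_eq {k : ℕ} {b : Fin k → ℤ} (hb : IsBridge b) :
    ∃ x, walkOf x = b := by
  set c : Fin (k + 1) → ℤ := Fin.cons 0 b with hc
  let x : Fin k →₀ ℕ :=
    Finsupp.equivFunOnFinite.symm fun i => (c i.succ - c i.castSucc + 1).toNat
  have hx : ∀ i, (x i : ℤ) = c i.succ - c i.castSucc + 1 := fun i =>
    Int.toNat_of_nonneg (by have : -1 ≤ c i.succ - c i.castSucc := hb.1 i; omega)
  have hcons : ∀ i, (Fin.cons 0 (walkOf x) : Fin (k + 1) → ℤ) i = c i := by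
    intro i
    induction i using Fin.induction with
    | zero => simp [hc]
    | succ i ih =>
      have := cons_walkOf_increment x i
      rw [hx, ih] at this
      omega
  exact ⟨x, funext fun i => by simpa [hc] using hcons i.succ⟩

/-- The finite set of bridges. -/
def bridges (k : ℕ) : Finset (Fin k → ℤ) :=
  (Finset.univ.finsuppAntidiag k).map ⟨walkOf, walkOf_injective k⟩

lemma mem_bridges {k : ℕ} {b : Fin k → ℤ} : b ∈ bridges k ↔ IsBridge b := by
  simp only [bridges, Finset.mem_map, Finset.mem_finsuppAntidiag, Finset.subset_univ, and_true,
    Function.Embedding.coeFn_mk]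
  constructor
  · rintro ⟨x, hx, rfl⟩
    exact (isBridge_walkOf_iff x).2 hx
  · intro hb
    obtain ⟨x, rfl⟩ := hb.exists_walkOf_eq
    exact ⟨x, (isBridge_walkOf_iff x).1 hb, rfl⟩

lemma card_bridges (k : ℕ) : (bridges k).card = k.multichoose k := by
  simp [bridges, Finset.card_finsuppAntidiag_nat_eq_multichoose]

lemma sum_bridges_pow_four_le (k : ℕ) (i : Fin k) (hi : i.val + 1 < k) :
    ∑ b ∈ bridges k, (b i : ℝ) ^ 4 ≤
      100 * ((i.val + 1 : ℕ) : ℝ) ^ 2 * (k.multichoose k : ℝ) := by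
  set s : Finset (Fin k) := Finset.univ.filter (fun l : Fin k => l.val < i.val + 1) with hs
  have hcard : s.card = i.val + 1 := by
    have : s = Finset.Iic i := by
      ext l
      simp only [hs, Finset.mem_filter, Finset.mem_univ, true_and, Finset.mem_Iic, Fin.le_def]
      omega
    rw [this, Fin.card_Iic]
  have hcard' : sᶜ.card = k - (i.val + 1) := by
    rw [Finset.card_compl, hcard, Fintype.card_fin]
  have h := sum_finsuppAntidiag_union (R := ℝ) (_root_.disjoint_compl_right (a := s)) k
    (fun a => ((a : ℝ) - (i.val + 1 : ℕ)) ^ 4)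
  rw [hcard, hcard', Finset.union_compl] at h
  have hk : i.val + 1 + (k - (i.val + 1)) = k := by omega
  have hle := sum_antidiagonal_sub_pow_four_le (i.val + 1) (k - (i.val + 1))
    (by omega) (by omega)
  rw [hk, ← h] at hle
  rw [bridges, Finset.sum_map]
  refine le_of_eq_of_le (Finset.sum_congr rfl fun x _ => ?_) hle
  simp only [Function.Embedding.coeFn_mk, walkOf]
  push_cast
  rfl

/-- No measurability of `X` is needed, by the convention on the Bochner integral. -/
lemma integral_comp_le_sum_of_measure_fiber {Ω β : Type*} [MeasurableSpace Ω] [Countable β]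
    {μ : Measure Ω} {X : Ω → β} {T : Finset β} {c : ℝ≥0∞} (hc : c ≠ ∞)
    (hT : ∀ b ∈ T, μ {ω | X ω = b} = c) (hT' : ∀ b ∉ T, μ {ω | X ω = b} = 0)
    {f : β → ℝ} (hf : ∀ b, 0 ≤ f b) :
    ∫ ω, f (X ω) ∂μ ≤ (∑ b ∈ T, f b) * c.toReal := by
  have hnonneg : 0 ≤ (∑ b ∈ T, f b) * c.toReal :=
    mul_nonneg (Finset.sum_nonneg fun b _ => hf b) ENNReal.toReal_nonneg
  by_cases hint : Integrable (fun ω => f (X ω)) μ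
  swap
  · rwa [integral_undef hint]
  have hae : ∀ᵐ ω ∂μ, X ω ∈ T := by
    have hsub : {ω | ¬ X ω ∈ T} ⊆ ⋃ b : {b // b ∉ T}, {ω | X ω = b} := fun ω hω =>
      Set.mem_iUnion.2 ⟨⟨X ω, hω⟩, rfl⟩
    exact measure_mono_null hsub (measure_iUnion_null fun b => hT' b b.2)
  rw [integral_eq_lintegral_of_nonneg_ae (Eventually.of_forall fun ω => hf _) hint.1]
  refine ENNReal.toReal_le_of_le_ofReal hnonneg ?_
  calc ∫⁻ ω, ENNReal.ofReal (f (X ω)) ∂μ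
      ≤ ∫⁻ ω, ∑ b ∈ T, (toMeasurable μ {ω | X ω = b}).indicator
          (fun _ => ENNReal.ofReal (f b)) ω ∂μ := by
        refine lintegral_mono_ae (hae.mono fun ω hω => ?_)
        refine le_trans ?_ (Finset.single_le_sum (fun _ _ => zero_le) hω)
        rw [Set.indicator_of_mem (subset_toMeasurable μ {ω' | X ω' = X ω} rfl)]
    _ = ∑ b ∈ T, ENNReal.ofReal (f b) * c := by
        rw [lintegral_finsetSum _ fun b _ =>
          measurable_const.indicator (measurableSet_toMeasurable _ _)]
        refine Finset.sum_congr rfl fun b hb => ?_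
        rw [lintegral_indicator_const (measurableSet_toMeasurable _ _),
          measure_toMeasurable, hT b hb]
    _ = ENNReal.ofReal ((∑ b ∈ T, f b) * c.toReal) := by
        rw [ENNReal.ofReal_mul (Finset.sum_nonneg fun b _ => hf b), ENNReal.ofReal_toReal hc,
          ENNReal.ofReal_sum_of_nonneg fun b _ => hf b, Finset.sum_mul]

/-- There is a constant `C > 0` such that for all integers `k > j ≥ 1`, a uniform
bridge `B(k,·)` of `𝓑_k^{≥−1}` satisfies `E[|B(k,j)|⁴] ≤ C j²`. -/
theorem stmt5 :
    ∃ C : ℝ, 0 < C ∧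
      ∀ (k j : ℕ) (hj : 1 ≤ j) (hjk : j < k)
        (Ω : Type) (_ : MeasurableSpace Ω) (μ : Measure Ω) (_ : IsProbabilityMeasure μ)
        (B : Ω → Fin k → ℤ),
        (∀ b : Fin k → ℤ, μ {ω | B ω = b} =
          if IsBridge b then (Nat.card {b' : Fin k → ℤ // IsBridge b'} : ℝ≥0∞)⁻¹ else 0) →
        ∫ ω, (|B ω ⟨j - 1, by omega⟩| : ℝ) ^ 4 ∂μ ≤ C * (j : ℝ) ^ 2 := by
  refine ⟨100, by norm_num, ?_⟩
  intro k j hj hjk Ω _ μ _ B hB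
  have hcard : Nat.card {b : Fin k → ℤ // IsBridge b} = k.multichoose k := by
    rw [Nat.subtype_card (bridges k) fun _ => mem_bridges, card_bridges]
  have hpos : 0 < k.multichoose k := by
    rw [Nat.multichoose_eq]
    exact Nat.choose_pos (by omega)
  rw [hcard] at hB
  have hle := integral_comp_le_sum_of_measure_fiber (μ := μ) (X := B) (T := bridges k)
    (c := (k.multichoose k : ℝ≥0∞)⁻¹) (by simp [hpos.ne'])
    (fun b hb => by rw [hB, if_pos (mem_bridges.1 hb)])
    (fun b hb => by rw [hB, if_neg (mt mem_bridges.2 hb)])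
    (f := fun b => (|(b ⟨j - 1, by omega⟩ : ℝ)|) ^ 4) (fun b => by positivity)
  refine hle.trans ?_
  have hsum := sum_bridges_pow_four_le k ⟨j - 1, by omega⟩
    (by simp only; omega)
  simp only [Nat.sub_add_cancel hj] at hsum
  have heven : Even 4 := by decide
  simp only [heven.pow_abs]
  rw [ENNReal.toReal_inv, ENNReal.toReal_natCast, ← div_eq_mul_inv,
    div_le_iff₀ (by exact_mod_cast hpos)]
  exact hsum
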